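/- Let n ∈ ℕ, let l be an integer with 3 ≤ l ≤ n/2, let ρ be an integer with ρ ≥ l/2, and let c₁, c₂ be disjoint monotone conjunctions over {0,1}^n with index sets of size l each. Let D be the uniform distribution on {0,1}^n and let m ∈ ℕ be such that (1 − 2^{−l})^{2m} ≥ 1/2. Then for every learning algorithm A mapping labeled m-samples to hypotheses, (1/2)·E_{S∼D^m}[R^E_ρ(A(S_{c₁}), c₁)] + (1/2)·E_{S∼D^m}[R^E_ρ(A(S_{c₂}), c₂)] ≥ (1 − 2^{−l})/8 > 0.1; in particular there exists a target c ∈ {c₁,c₂} with E_{S∼D^m}[R^E_ρ(A(S_c), c)] > 0.1. -/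

import Mathlib

open MeasureTheory ENNReal Filter

/-- Exact-in-the-ball robust risk `R^E_ρ(h,c)` on the Boolean hypercube. -/
noncomputable def RE (N ρ : ℕ) (μ : Measure (Fin N → Bool))
    (h c : (Fin N → Bool) → Bool) : ℝ≥0∞ :=
  μ {x | ∃ z : Fin N → Bool, hammingDist x z ≤ ρ ∧ h z ≠ c z}

/-- Constant-in-the-ball robust risk `R^C_ρ(h,c)` on the Boolean hypercube. -/
noncomputable def RC (N ρ : ℕ) (μ : Measure (Fin N → Bool))
    (h c : (Fin N → Bool) → Bool) : ℝ≥0∞ :=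
  μ {x | ∃ z : Fin N → Bool, hammingDist x z ≤ ρ ∧ h z ≠ c x}

/-- Label a sample `S` with target concept `c`. -/
def labelWith (n : ℕ) (c : (Fin n → Bool) → Bool) {m : ℕ}
    (S : Fin m → (Fin n → Bool)) : Fin m → (Fin n → Bool) × Bool :=
  fun i => (S i, c (S i))

/-- Expected exact-in-the-ball robust risk of learner `A` on an i.i.d. `m`-sample. -/
noncomputable def expRisk (n m ρ : ℕ) (μ : Measure (Fin n → Bool))
    (A : (Fin m → (Fin n → Bool) × Bool) → ((Fin n → Bool) → Bool))
    (c : (Fin n → Bool) → Bool) : ℝ≥0∞ :=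
  ∫⁻ S, RE n ρ μ (A (labelWith n c S)) c ∂(Measure.pi fun _ : Fin m => μ)

/-- Monotone conjunction with index set `I`. -/
def monConj (n : ℕ) (I : Finset (Fin n)) : (Fin n → Bool) → Bool :=
  fun x => decide (∀ i ∈ I, x i = true)

/-- Uniform distribution on the Boolean hypercube. -/
noncomputable def unif (n : ℕ) : Measure (Fin n → Bool) :=
  (PMF.uniformOfFintype (Fin n → Bool)).toMeasure

/-- `μ` is `α`-log-Lipschitz: every point has positive mass and the log of the
mass function is `log α`-Lipschitz w.r.t. Hamming distance. -/
def logLipschitz (n : ℕ) (α : ℝ) (μ : Measure (Fin n → Bool)) : Prop :=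
  (∀ x : Fin n → Bool, 0 < μ {x}) ∧
  ∀ x x' : Fin n → Bool, hammingDist x x' = 1 →
    |Real.log (μ {x}).toReal - Real.log (μ {x'}).toReal| ≤ Real.log α

instance isProbabilityMeasure_unif (n : ℕ) : IsProbabilityMeasure (unif n) := by
  unfold unif
  infer_instance

lemma unif_apply (n : ℕ) (s : Finset (Fin n → Bool)) :
    unif n (s : Set (Fin n → Bool)) = (s.card : ℝ≥0∞) / 2 ^ n := by
  classical
  rw [unif, PMF.toMeasure_uniformOfFintype_apply _ s.measurableSet]
  simp

/-- Bijections of the hypercube preserve the uniform distribution. -/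
lemma unif_preimage_equiv (n : ℕ) (e : (Fin n → Bool) ≃ (Fin n → Bool))
    (s : Set (Fin n → Bool)) : unif n (e ⁻¹' s) = unif n s := by
  classical
  have h : e ⁻¹' s = ((s.toFinset.map e.symm.toEmbedding : Finset _) : Set (Fin n → Bool)) := by
    ext x
    simp
  rw [h, unif_apply, Finset.card_map, ← unif_apply, Set.coe_toFinset]

lemma unif_monConj_true (n : ℕ) (I : Finset (Fin n)) :
    unif n {x | monConj n I x = true} = 2⁻¹ ^ I.card := by
  classical
  have h : {x | monConj n I x = true} =
      ((Fintype.piFinset fun i => if i ∈ I then {true} else Finset.univ :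
        Finset (Fin n → Bool)) : Set (Fin n → Bool)) := by
    ext x
    simp only [monConj, Set.mem_ofPred_eq, decide_eq_true_eq, Finset.mem_coe,
      Fintype.mem_piFinset]
    refine forall_congr' fun i => ?_
    by_cases hi : i ∈ I <;> simp [hi]
  have hcard : (Fintype.piFinset fun i => if i ∈ I then {true} else Finset.univ :
      Finset (Fin n → Bool)).card * 2 ^ I.card = 2 ^ n := by
    have h2 : ∏ i : Fin n, (if i ∈ I then 2 else 1) = 2 ^ I.card := by
      simp [Finset.prod_ite_mem]
    rw [Fintype.card_piFinset, ← h2, ← Finset.prod_mul_distrib]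
    have h3 : ∀ i ∈ (Finset.univ : Finset (Fin n)),
        (if i ∈ I then ({true} : Finset Bool) else Finset.univ).card *
          (if i ∈ I then 2 else 1) = 2 := by
      intro i _
      by_cases hi : i ∈ I <;> simp [hi]
    rw [Finset.prod_congr rfl h3]
    simp
  rw [h, unif_apply]
  have hcard' := congrArg (Nat.cast : ℕ → ℝ≥0∞) hcard
  push_cast at hcard'
  rw [← hcard', ← ENNReal.inv_pow, ENNReal.div_eq_inv_mul]
  have h0 : (Fintype.piFinset fun i => if i ∈ I then {true} else Finset.univ :
      Finset (Fin n → Bool)).card ≠ 0 := by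
    intro h0
    rw [h0, zero_mul] at hcard
    exact (pow_pos two_pos n).ne hcard
  rw [ENNReal.mul_inv (by simp) (by simp), mul_right_comm,
    ENNReal.inv_mul_cancel (by exact_mod_cast h0) (ENNReal.natCast_ne_top _), one_mul]

lemma unif_monConj_false (n : ℕ) (I : Finset (Fin n)) :
    unif n {x | monConj n I x = false} = 1 - 2⁻¹ ^ I.card := by
  have h : {x | monConj n I x = false} = {x | monConj n I x = true}ᶜ := by
    ext x
    simp
  rw [h, prob_compl_eq_one_sub (Set.toFinite _).measurableSet, unif_monConj_true]

/-- Two disjoint monotone conjunctions are independent, so both are false, and hence agree, with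
probability at least the product of the probabilities that each of them is false. -/
lemma le_unif_monConj_eq (n : ℕ) (I J : Finset (Fin n)) (hd : Disjoint I J) :
    (1 - 2⁻¹ ^ I.card) * (1 - 2⁻¹ ^ J.card) ≤ unif n {x | monConj n I x = monConj n J x} := by
  have hI := unif_monConj_true n I
  have hJ := unif_monConj_true n J
  have hIJ : unif n ({x | monConj n I x = true} ∩ {x | monConj n J x = true})
      = 2⁻¹ ^ I.card * 2⁻¹ ^ J.card := by
    classical
    rw [← pow_add, ← Finset.card_union_of_disjoint hd, ← unif_monConj_true]
    congr 1
    ext x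
    simp [monConj, or_imp, forall_and]
  have hU := measure_union_add_inter (μ := unif n) {x | monConj n I x = true}
    (t := {x | monConj n J x = true}) (Set.toFinite _).measurableSet
  have hc : unif n ({x | monConj n I x = true} ∪ {x | monConj n J x = true})ᶜ ≤
      unif n {x | monConj n I x = monConj n J x} := by
    refine measure_mono fun x hx => ?_
    simp_all
  refine le_trans ?_ hc
  rw [prob_compl_eq_one_sub (Set.toFinite _).measurableSet]
  rw [hI, hJ, hIJ] at hU
  set u := unif n ({x | monConj n I x = true} ∪ {x | monConj n J x = true})
  have hu : u ≤ 1 := prob_le_one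
  have hp : ∀ k : ℕ, (2⁻¹ : ℝ≥0∞) ^ k ≤ 1 := fun k => pow_le_one₀ zero_le (by simp)
  have hut : u ≠ ∞ := ne_top_of_le_ne_top one_ne_top hu
  generalize hpI : (2⁻¹ : ℝ≥0∞) ^ I.card = p at *
  generalize hpJ : (2⁻¹ : ℝ≥0∞) ^ J.card = q at *
  have hp1 : p ≤ 1 := hpI ▸ hp _
  have hq1 : q ≤ 1 := hpJ ▸ hp _
  have hpt : p ≠ ∞ := ne_top_of_le_ne_top one_ne_top hp1
  have hqt : q ≠ ∞ := ne_top_of_le_ne_top one_ne_top hq1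
  rw [← ENNReal.toReal_le_toReal (by finiteness) (by finiteness)]
  have hU' := congrArg ENNReal.toReal hU
  rw [ENNReal.toReal_add hut (by finiteness), ENNReal.toReal_add hpt hqt, ENNReal.toReal_mul]
    at hU'
  rw [ENNReal.toReal_mul, ENNReal.toReal_sub_of_le hp1 one_ne_top,
    ENNReal.toReal_sub_of_le hq1 one_ne_top, ENNReal.toReal_sub_of_le hu one_ne_top,
    ENNReal.toReal_one]
  linarith

/-- The exact-in-the-ball robust risk satisfies the triangle inequality. -/
lemma RE_le_add (n ρ : ℕ) (μ : Measure (Fin n → Bool)) (h c₁ c₂ : (Fin n → Bool) → Bool) :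
    RE n ρ μ c₁ c₂ ≤ RE n ρ μ h c₁ + RE n ρ μ h c₂ := by
  refine le_trans (measure_mono ?_) (measure_union_le _ _)
  rintro x ⟨z, hz, hne⟩
  by_cases hh : h z = c₁ z
  · exact Or.inr ⟨z, hz, hh ▸ hne⟩
  · exact Or.inl ⟨z, hz, hh⟩

/-- If the number of zeros of `x` on `I` is at most `ρ` and `x` violates `c_J`, then turning
the zeros on `I` into ones gives a point near `x` on which `c_I` and `c_J` disagree. -/
lemma exists_monConj_ne (n ρ : ℕ) (I J : Finset (Fin n)) (hd : Disjoint I J) (x : Fin n → Bool)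
    (hx : (I.filter fun i => x i = false).card ≤ ρ) (hJ : monConj n J x = false) :
    ∃ z, hammingDist x z ≤ ρ ∧ monConj n I z ≠ monConj n J z := by
  classical
  refine ⟨fun i => if i ∈ I then true else x i, ?_, ?_⟩
  · refine le_trans (Finset.card_le_card fun i hi => ?_) hx
    by_cases h : i ∈ I <;> simp_all
  · have h1 : monConj n I (fun i => if i ∈ I then true else x i) = true := by
      simp +contextual [monConj]
    have h2 : monConj n J (fun i => if i ∈ I then true else x i) = monConj n J x := by
      unfold monConj
      congr 1
      refine propext (forall₂_congr fun i hi => ?_)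
      simp only [if_neg (Finset.disjoint_right.mp hd hi)]
    rw [h1, h2, hJ]
    decide

/-- Flip the coordinates in `I`. -/
def flipOn {n : ℕ} (I : Finset (Fin n)) : (Fin n → Bool) ≃ (Fin n → Bool) :=
  Function.Involutive.toPerm (fun x i => if i ∈ I then !x i else x i) fun x => by
    funext i
    by_cases h : i ∈ I <;> simp [h]

lemma flipOn_apply {n : ℕ} (I : Finset (Fin n)) (x : Fin n → Bool) (i : Fin n) :
    flipOn I x i = if i ∈ I then !x i else x i := rfl

lemma monConj_flipOn {n : ℕ} (I J : Finset (Fin n)) (hd : Disjoint I J) (x : Fin n → Bool) :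
    monConj n J (flipOn I x) = monConj n J x := by
  unfold monConj
  congr 1
  refine propext (forall₂_congr fun i hi => ?_)
  rw [flipOn_apply, if_neg (Finset.disjoint_right.mp hd hi)]

/-- Two disjoint monotone conjunctions are far apart in exact-in-the-ball robust risk as soon as
the radius is at least half the length of one of them. -/
lemma le_RE_monConj (n ρ : ℕ) (I J : Finset (Fin n)) (hd : Disjoint I J)
    (hρ : I.card ≤ 2 * ρ) :
    (1 - 2⁻¹ ^ J.card) / 2 ≤ RE n ρ (unif n) (monConj n I) (monConj n J) := by
  set E : Set (Fin n → Bool) :=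
    {x | (I.filter fun i => x i = false).card ≤ ρ ∧ monConj n J x = false}
  have hE : unif n E ≤ RE n ρ (unif n) (monConj n I) (monConj n J) :=
    measure_mono fun x hx => exists_monConj_ne n ρ I J hd x hx.1 hx.2
  refine le_trans ?_ hE
  refine ENNReal.div_le_of_le_mul ?_
  rw [← unif_monConj_false, mul_two]
  nth_rewrite 2 [← unif_preimage_equiv n (flipOn I)]
  refine le_trans (measure_mono fun x hx => ?_) (measure_union_le _ _)
  have hx' : monConj n J x = false := hx
  by_cases h : (I.filter fun i => x i = false).card ≤ ρ
  · exact Or.inr ⟨h, hx'⟩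
  · refine Or.inl ⟨?_, (monConj_flipOn I J hd x).trans hx'⟩
    have h1 : (I.filter fun i => flipOn I x i = false) = I.filter fun i => ¬ x i = false := by
      refine Finset.filter_congr fun i hi => ?_
      simp [flipOn_apply, hi]
    rw [h1]
    have h2 := Finset.card_filter_add_card_filter_not (s := I) (fun i => x i = false)
    omega

/-- If `c₁` and `c₂` agree on a random point with probability `p`, then no learner can tell them
apart with probability `p ^ m`, and in this case it pays at least their distance. -/
lemma le_expRisk_add (n m ρ : ℕ) (μ : Measure (Fin n → Bool)) [IsProbabilityMeasure μ]
    (A : (Fin m → (Fin n → Bool) × Bool) → ((Fin n → Bool) → Bool))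
    (c₁ c₂ : (Fin n → Bool) → Bool) :
    RE n ρ μ c₁ c₂ * μ {x | c₁ x = c₂ x} ^ m ≤
      expRisk n m ρ μ A c₁ + expRisk n m ρ μ A c₂ := by
  have hT : Measure.pi (fun _ : Fin m => μ) (Set.univ.pi fun _ => {x | c₁ x = c₂ x}) =
      μ {x | c₁ x = c₂ x} ^ m := by
    simp [Measure.pi_pi]
  rw [← hT, ← setLIntegral_const, expRisk, expRisk,
    ← lintegral_add_left (measurable_of_finite _)]
  refine le_trans (setLIntegral_mono' (Set.toFinite _).measurableSet fun S hS => ?_)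
    (setLIntegral_le_lintegral _ _)
  have hl : labelWith n c₂ S = labelWith n c₁ S := by
    funext i
    exact Prod.ext rfl (hS i trivial).symm
  rw [hl]
  exact RE_le_add n ρ μ _ c₁ c₂

lemma one_div_ten_lt_one_sub_pow_div_eight {l : ℕ} (hl : 3 ≤ l) :
    (1 : ℝ≥0∞) / 10 < (1 - 2⁻¹ ^ l) / 8 := by
  have h3 : (2⁻¹ : ℝ≥0∞) ^ l ≤ 2⁻¹ ^ 3 := pow_le_pow_right_of_le_one' (by simp) hl
  refine lt_of_lt_of_le ?_ (ENNReal.div_le_div_right (tsub_le_tsub_left h3 1) 8)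
  have h1 : (2⁻¹ : ℝ≥0∞) ^ 3 ≤ 1 := pow_le_one₀ zero_le (by simp)
  rw [← ENNReal.toReal_lt_toReal (by finiteness) (by finiteness), ENNReal.toReal_div,
    ENNReal.toReal_div, ENNReal.toReal_sub_of_le h1 one_ne_top]
  norm_num

/-- for disjoint monotone conjunctions of length `3 ≤ l ≤ n/2`,
radius `ρ ≥ l/2`, and a sample size `m` with `(1-2^{-l})^{2m} ≥ 1/2`, every
learner has average expected robust risk `≥ (1-2^{-l})/8 > 0.1` against the two
targets; in particular one of the two targets has expected robust risk `> 0.1`. -/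
theorem stmt7 (n l ρ m : ℕ) (hl3 : 3 ≤ l) (hln : 2 * l ≤ n) (hρ : l ≤ 2 * ρ)
    (I₁ I₂ : Finset (Fin n)) (hdisj : Disjoint I₁ I₂)
    (h1 : I₁.card = l) (h2 : I₂.card = l)
    (hm : (2⁻¹ : ℝ≥0∞) ≤ (1 - 2⁻¹ ^ l) ^ (2 * m))
    (A : (Fin m → (Fin n → Bool) × Bool) → ((Fin n → Bool) → Bool)) :
    (2⁻¹ * expRisk n m ρ (unif n) A (monConj n I₁)
      + 2⁻¹ * expRisk n m ρ (unif n) A (monConj n I₂) ≥ (1 - 2⁻¹ ^ l) / 8) ∧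
    ((1 - 2⁻¹ ^ l : ℝ≥0∞) / 8 > 1 / 10) ∧
    (expRisk n m ρ (unif n) A (monConj n I₁) > 1 / 10 ∨
     expRisk n m ρ (unif n) A (monConj n I₂) > 1 / 10) := by
  have hgap := one_div_ten_lt_one_sub_pow_div_eight hl3
  have hmain : (1 - 2⁻¹ ^ l) / 8 ≤ 2⁻¹ * expRisk n m ρ (unif n) A (monConj n I₁)
      + 2⁻¹ * expRisk n m ρ (unif n) A (monConj n I₂) := by
    have hagree : (2⁻¹ : ℝ≥0∞) ≤ unif n {x | monConj n I₁ x = monConj n I₂ x} ^ m := by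
      refine hm.trans ?_
      rw [pow_mul]
      gcongr
      have h := le_unif_monConj_eq n I₁ I₂ hdisj
      rwa [h1, h2, ← sq] at h
    have hdist := le_RE_monConj n ρ I₁ I₂ hdisj (h1.trans_le hρ)
    rw [h2] at hdist
    rw [← mul_add]
    calc (1 - 2⁻¹ ^ l : ℝ≥0∞) / 8 = 2⁻¹ * ((1 - 2⁻¹ ^ l) / 2 * 2⁻¹) := by
          have h8 : (8 : ℝ≥0∞)⁻¹ = 2⁻¹ * 2⁻¹ * 2⁻¹ := by
            rw [← ENNReal.mul_inv (by simp) (by simp), ← ENNReal.mul_inv (by simp) (by simp)]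
            norm_num
          rw [div_eq_mul_inv, div_eq_mul_inv, h8]
          ring
      _ ≤ _ := by
          gcongr
          exact (mul_le_mul' hdist hagree).trans (le_expRisk_add n m ρ (unif n) A _ _)
  refine ⟨hmain, hgap, ?_⟩
  by_contra! h
  refine (hgap.trans_le hmain).not_ge ?_
  calc 2⁻¹ * expRisk n m ρ (unif n) A (monConj n I₁)
        + 2⁻¹ * expRisk n m ρ (unif n) A (monConj n I₂)
      ≤ 2⁻¹ * (1 / 10) + 2⁻¹ * (1 / 10) := by
        gcongr
        · exact h.1
        · exact h.2
    _ = 1 / 10 := by rw [← add_mul, ENNReal.inv_two_add_inv_two, one_mul]
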